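/- arXiv:math/0609043 — 4 statements merged into one kernel-verified Lean document; each statement's English description precedes it below -/
import Mathlib

section
/- Let k be a natural number, let A ∈ ℝ^{1+k} satisfy ⟨A,A⟩ > 0, and let α < 0 be a real number. Then the restriction of the map x ↦ ⟨A,x⟩ to the level set {x ∈ ℝ^{1+k} : ⟨x,x⟩ = α} is a proper map; equivalently, for every compact C ⊆ ℝ, the set {x ∈ ℝ^{1+k} : ⟨x,x⟩ = α and ⟨A,x⟩ ∈ C} is compact. (This is the paper's properness statement for the period map E ↦ ω(E) = ⟨A,E⟩ on a fixed negative self-intersection level, where A is the Poincaré dual of the symplectic class and the form has signature (1,k), i.e. b₂⁺ = 1.) -/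
/-- The Minkowski bilinear form on `ℝ^{1+k}`:
`⟨x,y⟩ = (x 0)(y 0) − ∑_{i=1}^k (x i)(y i)`. -/
def mink (k : ℕ) (x y : Fin (k + 1) → ℝ) : ℝ :=
  x 0 * y 0 - ∑ i : Fin k, x i.succ * y i.succ

theorem continuous_mink (k : ℕ) : Continuous fun p : (Fin (k + 1) → ℝ) × (Fin (k + 1) → ℝ) =>
    mink k p.1 p.2 := by
  unfold mink
  fun_prop

/-- A point of negative square, whose product with a fixed positive vector is bounded by `M`, has
bounded spatial part. -/
theorem sum_sq_le_of_mink_neg {k : ℕ} {A x : Fin (k + 1) → ℝ} {α M : ℝ}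
    (hA : 0 < mink k A A) (hx : mink k x x = α) (hM : |mink k A x| ≤ M) :
    ∑ i : Fin k, x i.succ ^ 2 ≤
      2 * ((1 + 2 * A 0 ^ 2 / mink k A A) * M ^ 2 - A 0 ^ 2 * α) / mink k A A := by
  have hcs := Finset.sum_mul_sq_le_sq_mul_sq Finset.univ
    (fun i : Fin k => A i.succ) (fun i : Fin k => x i.succ)
  have hB : 0 ≤ ∑ i : Fin k, A i.succ ^ 2 := Finset.sum_nonneg fun i _ => sq_nonneg _
  have hS : 0 ≤ ∑ i : Fin k, x i.succ ^ 2 := Finset.sum_nonneg fun i _ => sq_nonneg _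
  have hAx : mink k A x = A 0 * x 0 - ∑ i : Fin k, A i.succ * x i.succ := rfl
  have hAA : mink k A A = A 0 ^ 2 - ∑ i : Fin k, A i.succ ^ 2 := by simp only [mink, pow_two]
  have hxx : α = x 0 ^ 2 - ∑ i : Fin k, x i.succ ^ 2 := by rw [← hx]; simp only [mink, pow_two]
  have hc : mink k A x ^ 2 ≤ M ^ 2 := sq_le_sq' (abs_le.1 hM).1 (abs_le.1 hM).2
  generalize mink k A A = q at *
  generalize mink k A x = c at *
  generalize ∑ i : Fin k, A i.succ ^ 2 = B at *
  generalize ∑ i : Fin k, x i.succ ^ 2 = S at *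
  generalize ∑ i : Fin k, A i.succ * x i.succ = t at *
  have ha : 0 < A 0 ^ 2 := by linarith
  have ha0 : A 0 ≠ 0 := by intro h; simp [h] at ha
  obtain ⟨ε, hε⟩ : ∃ ε, ε = q / (2 * A 0 ^ 2) := ⟨_, rfl⟩
  have hε0 : 0 < ε := by rw [hε]; positivity
  have hεa : ε * A 0 ^ 2 = q / 2 := by rw [hε]; field_simp
  have hinv : 2 * A 0 ^ 2 / q = 1 / ε := by rw [hε]; field_simp
  have hεB : ε * B ≤ q / 2 := by nlinarith
  have young : 2 * c * t ≤ ε * t ^ 2 + 1 / ε * c ^ 2 := by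
    have h : ε * t ^ 2 + 1 / ε * c ^ 2 - 2 * c * t = (ε * t - c) ^ 2 / ε := by field_simp; ring
    have : 0 ≤ (ε * t - c) ^ 2 / ε := by positivity
    linarith
  have hsq : A 0 ^ 2 * (S + α) = (c + t) ^ 2 := by rw [hAx, hxx]; ring
  have h1 : (1 + ε) * t ^ 2 ≤ (1 + ε) * (B * S) := by gcongr
  have h2 : (1 + 1 / ε) * c ^ 2 ≤ (1 + 1 / ε) * M ^ 2 := by gcongr
  have h3 : ε * B * S ≤ q / 2 * S := by gcongr
  have h4 : q * S = A 0 ^ 2 * S - B * S := by rw [hAA]; ring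
  rw [hinv, le_div_iff₀ hA]
  linarith

/-- If `⟨A,A⟩ > 0` and `α < 0`, then the restriction of
`x ↦ ⟨A,x⟩` to the level set `{x | ⟨x,x⟩ = α}` is proper: for every compact
`C ⊆ ℝ`, the set `{x | ⟨x,x⟩ = α ∧ ⟨A,x⟩ ∈ C}` is compact. -/
theorem period_map_proper_on_negative_level (k : ℕ) (A : Fin (k + 1) → ℝ)
    (hA : 0 < mink k A A) (α : ℝ) (hα : α < 0) :
    ∀ C : Set ℝ, IsCompact C →
      IsCompact {x : Fin (k + 1) → ℝ | mink k x x = α ∧ mink k A x ∈ C} := by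
  intro C hC
  obtain ⟨M, hM⟩ := hC.isBounded.exists_norm_le
  obtain ⟨R, hR⟩ : ∃ R, R =
      2 * ((1 + 2 * A 0 ^ 2 / mink k A A) * M ^ 2 - A 0 ^ 2 * α) / mink k A A := ⟨_, rfl⟩
  have hdiag : Continuous fun x => mink k x x :=
    (continuous_mink k).comp (continuous_id.prodMk continuous_id)
  have hleft : Continuous fun x => mink k A x :=
    (continuous_mink k).comp (continuous_const.prodMk continuous_id)
  refine (isCompact_closedBall (0 : Fin (k + 1) → ℝ) √R).of_isClosed_subset
    ((isClosed_eq hdiag continuous_const).inter (hC.isClosed.preimage hleft)) ?_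
  rintro x ⟨hx, hxC⟩
  have hS : ∑ i : Fin k, x i.succ ^ 2 ≤ R := hR ▸ sum_sq_le_of_mink_neg hA hx (hM _ hxC)
  rw [mem_closedBall_zero_iff, pi_norm_le_iff_of_nonneg (Real.sqrt_nonneg R)]
  intro i
  refine Real.abs_le_sqrt ?_
  refine Fin.cases ?_ (fun j => ?_) i
  · simp only [mink, ← pow_two] at hx
    linarith
  · exact (Finset.single_le_sum (f := fun i : Fin k => x i.succ ^ 2)
      (fun i _ => sq_nonneg _) (Finset.mem_univ j)).trans hS
end

section
/- Let k be a natural number, let A ∈ ℝ^{1+k} satisfy ⟨A,A⟩ > 0, and let K ≥ 0 be a real number. Then the set of integer vectors {E ∈ ℤ^{1+k} : ⟨E,E⟩ = −1 and 0 ≤ ⟨A,E⟩ ≤ K} is finite, where an integer vector is paired with A via the Minkowski form after the coercion ℤ^{1+k} → ℝ^{1+k}. -/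
/-- If `A` is timelike, the time coordinate of a vector `x` with `⟨x,x⟩ = -1` and
`|⟨A,x⟩| ≤ K` is bounded in terms of `A` and `K`. -/
theorem sq_time_coord_le_of_mink_self_eq_neg_one {k : ℕ} {A x : Fin (k + 1) → ℝ}
    (hA : 0 < mink k A A) {K : ℝ} (hx : mink k x x = -1) (hAx : |mink k A x| ≤ K) :
    x 0 ^ 2 ≤ (2 * (∑ i : Fin k, A i.succ ^ 2) * mink k A A + 4 * A 0 ^ 2 * K ^ 2) /
      mink k A A ^ 2 := by
  have cauchy := Finset.sum_mul_sq_le_sq_mul_sq Finset.univ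
    (fun i : Fin k => A i.succ) (fun i : Fin k => x i.succ)
  have ht : mink k A x ^ 2 ≤ K ^ 2 := sq_le_sq' (abs_le.mp hAx).1 (abs_le.mp hAx).2
  have hAA : mink k A A = A 0 ^ 2 - ∑ i : Fin k, A i.succ ^ 2 := by simp only [mink, sq]
  have hxx : ∑ i : Fin k, x i.succ ^ 2 = x 0 ^ 2 + 1 := by
    simp only [mink, ← sq] at hx
    linarith
  have hS : ∑ i : Fin k, A i.succ * x i.succ = A 0 * x 0 - mink k A x := by
    simp only [mink]
    ring
  rw [hxx, hS] at cauchy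
  rw [le_div_iff₀ (by positivity)]
  set d := mink k A A
  set t := mink k A x
  set s := ∑ i : Fin k, A i.succ ^ 2
  have quad : d * x 0 ^ 2 ≤ s + 2 * A 0 * t * x 0 := by
    rw [hAA]
    nlinarith [sq_nonneg t]
  have scaled := mul_le_mul_of_nonneg_left quad hA.le
  have hAt := mul_le_mul_of_nonneg_left ht (sq_nonneg (A 0))
  nlinarith [sq_nonneg (d * x 0 - 2 * A 0 * t)]

/-- If `⟨A,A⟩ > 0` and `K ≥ 0`, then the set of integer vectors
`{E : ℤ^{1+k} | ⟨E,E⟩ = −1 ∧ 0 ≤ ⟨A,E⟩ ≤ K}` is finite, where `E` is coerced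
to `ℝ^{1+k}` componentwise. -/
theorem lattice_exceptional_classes_finite (k : ℕ) (A : Fin (k + 1) → ℝ)
    (hA : 0 < mink k A A) (K : ℝ) (hK : 0 ≤ K) :
    Set.Finite {E : Fin (k + 1) → ℤ |
      mink k (fun i => (E i : ℝ)) (fun i => (E i : ℝ)) = -1 ∧
        0 ≤ mink k A (fun i => (E i : ℝ)) ∧
        mink k A (fun i => (E i : ℝ)) ≤ K} := by
  obtain ⟨B, hB⟩ : ∃ B : ℝ, ∀ x : Fin (k + 1) → ℝ, mink k x x = -1 → |mink k A x| ≤ K →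
      x 0 ^ 2 ≤ B :=
    ⟨_, fun _ => sq_time_coord_le_of_mink_self_eq_neg_one hA⟩
  refine (Set.finite_Icc (fun _ : Fin (k + 1) => -⌈B + 1⌉) (fun _ => ⌈B + 1⌉)).subset ?_
  rintro E ⟨hE, hAE₀, hAE⟩
  have h_time := hB _ hE (abs_le.mpr ⟨by linarith, hAE⟩)
  have h_sq : ∀ i, (E i : ℝ) ^ 2 ≤ B + 1 := by
    refine Fin.cases (by linarith) fun i => ?_
    have h_single := Finset.single_le_sum (f := fun j : Fin k => (E j.succ : ℝ) ^ 2)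
      (fun j _ => sq_nonneg _) (Finset.mem_univ i)
    simp only [mink, ← sq] at hE
    linarith
  have h_abs : ∀ i, |E i| ≤ ⌈B + 1⌉ := fun i => by
    have h_int : E i ^ 2 ≤ ⌈B + 1⌉ := by
      exact_mod_cast (h_sq i).trans (Int.le_ceil _)
    exact (abs_le.mpr ⟨by linarith [Int.le_self_sq (-E i), neg_sq (E i)],
      Int.le_self_sq (E i)⟩).trans h_int
  exact ⟨fun i => (abs_le.mp (h_abs i)).1, fun i => (abs_le.mp (h_abs i)).2⟩
end

section
/- Let k be a natural number and let C ∈ ℝ^{1+k} satisfy ⟨C,C⟩ > 0. Then the set {E ∈ ℝ^{1+k} : ⟨E,E⟩ = −1 and ⟨C,E⟩ = 1} is a compact subset of ℝ^{1+k}. (This is the compactness claim of the paper's Remark 3.4, with C the Poincaré dual of the first Chern class, which has positive self-intersection for a blow-up of ℂP² at eight or fewer points.) -/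
/-- A slice of the unit hyperboloid by a timelike affine hyperplane is bounded, coordinatewise. -/
lemma exists_sq_le_of_mink_slice (k : ℕ) (C : Fin (k + 1) → ℝ) (hC : 0 < mink k C C) :
    ∃ B : ℝ, ∀ E : Fin (k + 1) → ℝ, mink k E E = -1 → mink k C E = 1 → ∀ i, E i ^ 2 ≤ B := by
  set q := ∑ i : Fin k, C i.succ ^ 2 with hq
  set d := mink k C C with hd
  have hdq : d = C 0 ^ 2 - q := by simp only [hd, hq, mink, sq]
  refine ⟨2 * (2 * C 0 ^ 2 / d + q) / d + 1, fun E hE hCE => ?_⟩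
  have hS : ∑ i : Fin k, E i.succ ^ 2 = E 0 ^ 2 + 1 := by
    simp only [mink, ← sq] at hE
    linarith
  have hp : ∑ i : Fin k, C i.succ * E i.succ = C 0 * E 0 - 1 := by
    simp only [mink] at hCE
    linarith
  have hcs := Finset.sum_mul_sq_le_sq_mul_sq Finset.univ (fun i : Fin k => C i.succ)
    (fun i : Fin k => E i.succ)
  rw [hp, hS, ← hq] at hcs
  have hyoung : 2 * (C 0 * E 0) ≤ d / 2 * E 0 ^ 2 + 2 * C 0 ^ 2 / d := by
    have h : d / 2 * E 0 ^ 2 + 2 * C 0 ^ 2 / d - 2 * (C 0 * E 0)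
        = (d * E 0 - 2 * C 0) ^ 2 / (2 * d) := by
      field_simp
      ring
    have : 0 ≤ (d * E 0 - 2 * C 0) ^ 2 / (2 * d) := by positivity
    linarith
  have hquad : d * E 0 ^ 2 ≤ 2 * (C 0 * E 0) + q - 1 := by
    rw [hdq]
    linarith
  have h0 : E 0 ^ 2 ≤ 2 * (2 * C 0 ^ 2 / d + q) / d := by
    rw [le_div_iff₀ hC]
    linarith
  intro i
  refine Fin.cases ?_ (fun j => ?_) i
  · linarith
  · have := Finset.single_le_sum (f := fun i : Fin k => E i.succ ^ 2)
      (fun i _ => sq_nonneg _) (Finset.mem_univ j)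
    simp only [hS] at this
    linarith

/-- If `⟨C,C⟩ > 0`, then the set
`{E : ℝ^{1+k} | ⟨E,E⟩ = −1 ∧ ⟨C,E⟩ = 1}` is compact. -/
theorem chern_slice_compact (k : ℕ) (C : Fin (k + 1) → ℝ)
    (hC : 0 < mink k C C) :
    IsCompact {E : Fin (k + 1) → ℝ | mink k E E = -1 ∧ mink k C E = 1} := by
  obtain ⟨B, hB⟩ := exists_sq_le_of_mink_slice k C hC
  refine (isCompact_univ_pi fun _ => isCompact_Icc (a := -√B) (b := √B)).of_isClosed_subset
    ?_ fun E hE i _ => Set.mem_Icc.mpr (abs_le.mp (Real.abs_le_sqrt (hB E hE.1 hE.2 i)))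
  simp only [mink]
  exact (isClosed_eq (by fun_prop) continuous_const).inter
    (isClosed_eq (by fun_prop) continuous_const)
end

section
/- Let k be a natural number and let C ∈ ℤ^{1+k} satisfy ⟨C,C⟩ > 0. Then the set of integer vectors {E ∈ ℤ^{1+k} : ⟨E,E⟩ = −1 and ⟨C,E⟩ = 1} is finite. (This is the finiteness claim of the paper's Remark 3.4: on a blow-up of ℂP² at eight or fewer points there are only finitely many homology classes of self-intersection −1 and Chern number 1.) -/
/-- The Minkowski bilinear form on `ℤ^{1+k}`:
`⟨x,y⟩ = (x 0)(y 0) − ∑_{i=1}^k (x i)(y i)`. -/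
def minkInt (k : ℕ) (x y : Fin (k + 1) → ℤ) : ℤ :=
  x 0 * y 0 - ∑ i : Fin k, x i.succ * y i.succ

/-- If `⟨C,C⟩ > 0`, `⟨E,E⟩ = −1` and `⟨C,E⟩ = 1`, then the time coordinate of `E` is bounded in
terms of that of `C`. -/
theorem sq_time_le_of_minkInt {k : ℕ} {C E : Fin (k + 1) → ℤ} (hC : 0 < minkInt k C C)
    (hE : minkInt k E E = -1) (hCE : minkInt k C E = 1) : E 0 ^ 2 ≤ 6 * C 0 ^ 2 := by
  have cauchy_schwarz := Finset.sum_mul_sq_le_sq_mul_sq Finset.univ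
    (fun i : Fin k => C i.succ) (fun i => E i.succ)
  simp only [minkInt, ← sq] at hC hE hCE
  have hq : ∑ i : Fin k, E i.succ ^ 2 = E 0 ^ 2 + 1 := by linarith
  have hp : ∑ i : Fin k, C i.succ * E i.succ = C 0 * E 0 - 1 := by linarith
  rw [hq, hp] at cauchy_schwarz
  have hs : ∑ i : Fin k, C i.succ ^ 2 ≤ C 0 ^ 2 - 1 := by linarith
  have := mul_le_mul_of_nonneg_right hs (by positivity : 0 ≤ E 0 ^ 2 + 1)
  nlinarith [sq_nonneg (E 0 - 2 * C 0)]

/-- Every coordinate of a vector with `⟨E,E⟩ = −1` is bounded in terms of its time coordinate. -/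
theorem sq_apply_le_of_minkInt_self {k : ℕ} {E : Fin (k + 1) → ℤ}
    (hE : minkInt k E E = -1) (i : Fin (k + 1)) : E i ^ 2 ≤ E 0 ^ 2 + 1 := by
  refine Fin.cases (by linarith) (fun j => ?_) i
  have := Finset.single_le_sum (f := fun j : Fin k => E j.succ ^ 2)
    (fun _ _ => sq_nonneg _) (Finset.mem_univ j)
  simp only [minkInt, ← sq] at hE this
  linarith

/-- If `C : ℤ^{1+k}` satisfies `⟨C,C⟩ > 0`, then the set of
integer vectors `{E : ℤ^{1+k} | ⟨E,E⟩ = −1 ∧ ⟨C,E⟩ = 1}` is finite. -/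
theorem lattice_chern_slice_finite (k : ℕ) (C : Fin (k + 1) → ℤ)
    (hC : 0 < minkInt k C C) :
    Set.Finite {E : Fin (k + 1) → ℤ |
      minkInt k E E = -1 ∧ minkInt k C E = 1} := by
  refine (Set.finite_Icc (fun _ : Fin (k + 1) => -(6 * C 0 ^ 2 + 1))
    (fun _ => 6 * C 0 ^ 2 + 1)).subset ?_
  rintro E ⟨hE, hCE⟩
  have bound (i : Fin (k + 1)) : |E i| ≤ 6 * C 0 ^ 2 + 1 := by
    refine abs_le_of_sq_le_sq ?_ (by positivity)
    nlinarith [sq_time_le_of_minkInt hC hE hCE, sq_apply_le_of_minkInt_self hE i,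
      sq_nonneg (C 0), sq_nonneg (6 * C 0 ^ 2)]
  exact ⟨fun i => (abs_le.mp (bound i)).1, fun i => (abs_le.mp (bound i)).2⟩
end
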